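/- arXiv:2209.07102 — 2 statements merged into one kernel-verified Lean document; each statement's English description precedes it below -/
import Mathlib

section
/- For every n ∈ ℕ, the natural density of the set {k ∈ ℕ : t(k) = t(k+n)} exists and equals (1 + η(n))/2, and the natural density of the set {k ∈ ℕ : t(k) = −t(k+n)} exists and equals (1 − η(n))/2. (Here the natural density of a set A ⊆ ℕ is the limit, as N → ∞, of (1/N) · #{k < N : k ∈ A}.) -/
open Filter Topology Finset

/-- The Thue–Morse sequence, `t n = (-1)^{s₂(n)}`, where `s₂ n` is the binary digit sum.
It satisfies `t 0 = 1`, `t (2k) = t k`, `t (2k+1) = - t k`, with values in `{-1, 1}`. -/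
def t (n : ℕ) : ℤ := (-1) ^ ((Nat.digits 2 n).sum)

/-- The Thue–Morse autocorrelation function: `η 0 = 1`, `η 1 = -1/3`,
`η (2m) = η m` and `η (2m+1) = -(η m + η (m+1))/2`. -/
noncomputable def η : ℕ → ℝ
  | 0 => 1
  | 1 => -1/3
  | n + 2 =>
    if (n + 2) % 2 = 0 then η ((n + 2) / 2)
    else -(η ((n + 2) / 2) + η ((n + 2) / 2 + 1)) / 2
decreasing_by all_goals omega

theorem t_bit0 (k : ℕ) : t (2 * k) = t k := by
  rcases Nat.eq_zero_or_pos k with rfl | hk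
  · rfl
  · simp [t, Nat.digits_base_mul one_lt_two hk]

theorem t_bit1 (k : ℕ) : t (2 * k + 1) = -t k := by
  have h := Nat.digits_add_two_add_one 0 (2 * k)
  have h1 : (2 * k + 1) % 2 = 1 := by omega
  have h2 : (2 * k + 1) / 2 = k := by omega
  simp only [zero_add, h1, h2] at h
  rw [t, h, List.sum_cons, pow_add, pow_one, neg_one_mul, t]

theorem t_eq_one_or (k : ℕ) : t k = 1 ∨ t k = -1 := neg_one_pow_eq_or ℤ _

theorem η_bit0 {m : ℕ} (hm : 1 ≤ m) : η (2 * m) = η m := by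
  obtain ⟨j, rfl⟩ := Nat.exists_eq_add_of_le' hm
  have h : 2 * (j + 1) = 2 * j + 2 := by ring
  rw [h, η, if_pos (by omega)]
  congr 1
  omega

theorem η_bit1 {m : ℕ} (hm : 1 ≤ m) : η (2 * m + 1) = -(η m + η (m + 1)) / 2 := by
  obtain ⟨j, rfl⟩ := Nat.exists_eq_add_of_le' hm
  have h : 2 * (j + 1) + 1 = (2 * j + 1) + 2 := by ring
  have h' : (2 * j + 1 + 2) / 2 = j + 1 := by omega
  rw [h, η, if_neg (by omega), h']

/-- The correlation sum `∑ k < N, t k * t (k + n)`, as a real number. -/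
noncomputable def corrSum (n N : ℕ) : ℝ := ∑ k ∈ Finset.range N, (t k : ℝ) * t (k + n)

theorem corrSum_succ (n N : ℕ) : corrSum n (N + 1) = corrSum n N + t N * t (N + n) :=
  Finset.sum_range_succ _ _

theorem corrSum_zero_right (n : ℕ) : corrSum n 0 = 0 := Finset.sum_range_zero _

theorem corrSum_zero_left (N : ℕ) : corrSum 0 N = N := by
  have h (k : ℕ) : (t k : ℝ) * t k = 1 := by rcases t_eq_one_or k with h | h <;> simp [h]
  simp [corrSum, h]

theorem corrSum_bit0 (m N : ℕ) : corrSum (2 * m) (2 * N) = 2 * corrSum m N := by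
  induction N with
  | zero => simp [corrSum_zero_right]
  | succ N ih =>
    have h1 : 2 * N + 2 * m = 2 * (N + m) := by ring
    have h2 : 2 * N + 1 + 2 * m = 2 * (N + m) + 1 := by ring
    rw [show 2 * (N + 1) = 2 * N + 1 + 1 by ring, corrSum_succ, corrSum_succ, corrSum_succ, ih,
      h1, h2, t_bit0, t_bit0, t_bit1, t_bit1]
    push_cast
    ring

theorem corrSum_bit1 (m N : ℕ) :
    corrSum (2 * m + 1) (2 * N) = -(corrSum m N + corrSum (m + 1) N) := by
  induction N with
  | zero => simp [corrSum_zero_right]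
  | succ N ih =>
    have h1 : 2 * N + (2 * m + 1) = 2 * (N + m) + 1 := by ring
    have h2 : 2 * N + 1 + (2 * m + 1) = 2 * (N + (m + 1)) := by ring
    rw [show 2 * (N + 1) = 2 * N + 1 + 1 by ring, corrSum_succ, corrSum_succ, corrSum_succ,
      corrSum_succ, ih, h1, h2, t_bit0, t_bit0, t_bit1, t_bit1]
    push_cast
    ring

theorem corrSum_one_sq_le (N : ℕ) : (corrSum 1 N + N / 3) ^ 2 ≤ 4 * N := by
  induction N using Nat.strong_induction_on with
  | _ N ih =>
    rcases Nat.eq_zero_or_pos N with rfl | hN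
    · simp [corrSum_zero_right]
    obtain ⟨M, rfl | rfl⟩ := Nat.even_or_odd' N
    · have h := ih M (by omega)
      have e := corrSum_bit1 0 M
      rw [corrSum_zero_left] at e
      norm_num at e
      rw [e]
      push_cast
      have := Nat.cast_nonneg (α := ℝ) M
      nlinarith
    · have h := ih M (by omega)
      have e := corrSum_bit1 0 M
      rw [corrSum_zero_left] at e
      norm_num at e
      have ht : (t M : ℝ) * t M = 1 := by rcases t_eq_one_or M with h | h <;> simp [h]
      rw [corrSum_succ, e, t_bit0, t_bit1]
      push_cast
      rw [mul_neg, ht]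
      nlinarith [sq_nonneg (corrSum 1 M + M / 3 - 2 / 3)]

theorem exists_abs_le_sqrt_of_even {f : ℕ → ℝ} {B C : ℝ} (hB : 0 ≤ B) (hC : 0 ≤ C)
    (hstep : ∀ N, |f (N + 1) - f N| ≤ B) (heven : ∀ N : ℕ, |f (2 * N)| ≤ C * √N) :
    ∃ K, 0 ≤ K ∧ ∀ N : ℕ, |f N| ≤ K * √N := by
  refine ⟨C + B, by positivity, fun N => ?_⟩
  obtain ⟨M, rfl | rfl⟩ := Nat.even_or_odd' N
  · refine (heven M).trans ?_
    gcongr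
    · linarith
    · omega
  · have h1 : √(M : ℝ) ≤ √((2 * M + 1 : ℕ) : ℝ) := by gcongr; omega
    have h2 : 1 ≤ √((2 * M + 1 : ℕ) : ℝ) := Real.one_le_sqrt.2 (by exact_mod_cast by omega)
    have h3 := abs_add_le (f (2 * M + 1) - f (2 * M)) (f (2 * M))
    rw [sub_add_cancel] at h3
    have := heven M
    have := hstep (2 * M)
    nlinarith [mul_le_mul_of_nonneg_left h1 hC, mul_le_mul_of_nonneg_left h2 hB]

theorem abs_corrSum_error_step (n : ℕ) (N : ℕ) :
    |(corrSum n (N + 1) - η n * (N + 1 : ℕ)) - (corrSum n N - η n * N)| ≤ 1 + |η n| := by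
  have h : |(t N : ℝ) * t (N + n)| = 1 := by
    rcases t_eq_one_or N with h | h <;> rcases t_eq_one_or (N + n) with h' | h' <;> simp [h, h']
  have e : (corrSum n (N + 1) - η n * (N + 1 : ℕ)) - (corrSum n N - η n * N) =
      t N * t (N + n) - η n := by
    rw [corrSum_succ]
    push_cast
    ring
  rw [e, ← h]
  exact abs_sub _ _

theorem exists_abs_corrSum_sub_le (n : ℕ) :
    ∃ K, 0 ≤ K ∧ ∀ N : ℕ, |corrSum n N - η n * N| ≤ K * √N := by
  induction n using Nat.strong_induction_on with
  | _ n ih =>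
    obtain ⟨m, rfl | rfl⟩ := Nat.even_or_odd' n
    · rcases Nat.eq_zero_or_pos m with rfl | hm
      · exact ⟨0, le_rfl, fun N => by simp [corrSum_zero_left, η]⟩
      obtain ⟨K, hK, h⟩ := ih m (by omega)
      refine exists_abs_le_sqrt_of_even (by positivity) (mul_nonneg zero_le_two hK)
        (abs_corrSum_error_step (2 * m)) fun N => ?_
      rw [corrSum_bit0, η_bit0 hm]
      have e : 2 * corrSum m N - η m * (2 * N : ℕ) = 2 * (corrSum m N - η m * N) := by
        push_cast; ring
      rw [e, abs_mul, abs_two, mul_assoc]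
      linarith [h N]
    · rcases Nat.eq_zero_or_pos m with rfl | hm
      · refine ⟨2, zero_le_two, fun N => abs_le_of_sq_le_sq ?_ (by positivity)⟩
        rw [mul_pow, Real.sq_sqrt (Nat.cast_nonneg N)]
        have e : corrSum 1 N - η 1 * N = corrSum 1 N + N / 3 := by
          rw [η]
          ring
        norm_num only [e]
        exact corrSum_one_sq_le N
      obtain ⟨K, hK, h⟩ := ih m (by omega)
      obtain ⟨L, hL, h'⟩ := ih (m + 1) (by omega)
      refine exists_abs_le_sqrt_of_even (by positivity) (add_nonneg hK hL)
        (abs_corrSum_error_step (2 * m + 1)) fun N => ?_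
      rw [corrSum_bit1, η_bit1 hm]
      have e : -(corrSum m N + corrSum (m + 1) N) - -(η m + η (m + 1)) / 2 * (2 * N : ℕ) =
          -((corrSum m N - η m * N) + (corrSum (m + 1) N - η (m + 1) * N)) := by
        push_cast; ring
      rw [e, abs_neg]
      linarith [h N, h' N, abs_add_le (corrSum m N - η m * N) (corrSum (m + 1) N - η (m + 1) * N)]

theorem tendsto_corrSum_div (n : ℕ) :
    Tendsto (fun N : ℕ => corrSum n N / N) atTop (𝓝 (η n)) := by
  obtain ⟨K, -, h⟩ := exists_abs_corrSum_sub_le n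
  rw [tendsto_iff_norm_sub_tendsto_zero]
  have hlim : Tendsto (fun N : ℕ => K / √(N : ℝ)) atTop (𝓝 0) :=
    tendsto_const_nhds.div_atTop (Real.tendsto_sqrt_atTop.comp tendsto_natCast_atTop_atTop)
  refine squeeze_zero' (Eventually.of_forall fun _ => norm_nonneg _) ?_ hlim
  filter_upwards [eventually_gt_atTop 0] with N hN
  have hN' : (0 : ℝ) < N := Nat.cast_pos.2 hN
  have e : corrSum n N / N - η n = (corrSum n N - η n * N) / N := by field_simp
  rw [Real.norm_eq_abs, e, abs_div, abs_of_pos hN', div_le_div_iff₀ hN' (Real.sqrt_pos.2 hN')]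
  calc |corrSum n N - η n * N| * √N ≤ K * √N * √N := by gcongr; exact h N
    _ = K * N := by rw [mul_assoc, Real.mul_self_sqrt hN'.le]

theorem card_agree (n N : ℕ) :
    (((Finset.range N).filter (fun k => t k = t (k + n))).card : ℝ) = (N + corrSum n N) / 2 := by
  rw [Finset.card_filter, corrSum]
  push_cast
  have hN : (N : ℝ) = ∑ _k ∈ Finset.range N, (1 : ℝ) := by simp
  rw [hN, ← Finset.sum_add_distrib, Finset.sum_div]
  refine Finset.sum_congr rfl fun k _ => ?_
  rcases t_eq_one_or k with h | h <;> rcases t_eq_one_or (k + n) with h' | h' <;>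
    norm_num [h, h']

theorem card_disagree (n N : ℕ) :
    (((Finset.range N).filter (fun k => t k = -t (k + n))).card : ℝ) = (N - corrSum n N) / 2 := by
  rw [Finset.card_filter, corrSum]
  push_cast
  have hN : (N : ℝ) = ∑ _k ∈ Finset.range N, (1 : ℝ) := by simp
  rw [hN, ← Finset.sum_sub_distrib, Finset.sum_div]
  refine Finset.sum_congr rfl fun k _ => ?_
  rcases t_eq_one_or k with h | h <;> rcases t_eq_one_or (k + n) with h' | h' <;>
    norm_num [h, h']

/-- The natural density of `{k : t k = t (k+n)}` is `(1 + η n)/2`, and the natural density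
of `{k : t k = - t (k+n)}` is `(1 - η n)/2`. -/
theorem thue_morse_agreement_density (n : ℕ) :
    Tendsto (fun N : ℕ =>
        (1 / (N : ℝ)) * ((Finset.range N).filter (fun k => t k = t (k + n))).card)
      atTop (𝓝 ((1 + η n) / 2)) ∧
    Tendsto (fun N : ℕ =>
        (1 / (N : ℝ)) * ((Finset.range N).filter (fun k => t k = - t (k + n))).card)
      atTop (𝓝 ((1 - η n) / 2)) := by
  have h := tendsto_corrSum_div n
  constructor
  · refine ((h.const_add 1).div_const 2).congr' ?_
    filter_upwards [eventually_gt_atTop 0] with N hN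
    have hN' : (N : ℝ) ≠ 0 := Nat.cast_ne_zero.2 hN.ne'
    rw [card_agree]
    field_simp
  · refine ((h.const_sub 1).div_const 2).congr' ?_
    filter_upwards [eventually_gt_atTop 0] with N hN
    have hN' : (N : ℝ) ≠ 0 := Nat.cast_ne_zero.2 hN.ne'
    rw [card_disagree]
    field_simp
end

section
/- Fix n ≥ 2 and suppose L : (Fin (n−1) → ℕ) → ℝ satisfies the correlation recursion: for all tuples m = (m₁, …, m_{n−1}) of nonnegative integers and all r = (r₁, …, r_{n−1}) ∈ {0,1}^{n−1} with r = r₁ + ⋯ + r_{n−1}, L(2m₁ + r₁, …, 2m_{n−1} + r_{n−1}) = ((−1)^r / 2) · ( L(m₁, …, m_{n−1}) + (−1)^n · L(m₁ + r₁, …, m_{n−1} + r_{n−1}) ). Then for every r ∈ {0,1}^{n−1}, L(r₁, …, r_{n−1}) = ((−1)^r / (2 + (−1)^{n+r−1})) · L(0, …, 0); consequently, if L′ is any other function satisfying the same recursion and L′(0, …, 0) = L(0, …, 0), then L′ = L, i.e. the solution space of the recursion is one-dimensional. -/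
open Filter Topology Finset

/-- Any solution `L` of the correlation recursion is determined on the corners of the unit
hypercube by `L 0` via `L r = ((-1)^r / (2 + (-1)^{n+r-1})) · L 0`; consequently the
solution space of the recursion is one-dimensional: any two solutions agreeing at `0`
coincide. -/
theorem thue_morse_correlation_recursion_unique (n : ℕ) (hn : 2 ≤ n)
    (L : (Fin (n - 1) → ℕ) → ℝ)
    (hL : ∀ m r : Fin (n - 1) → ℕ, (∀ i, r i ≤ 1) →
      L (fun i => 2 * m i + r i) =
        ((-1 : ℝ) ^ (∑ i, r i) / 2) *
          (L m + (-1 : ℝ) ^ n * L (fun i => m i + r i))) :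
    (∀ r : Fin (n - 1) → ℕ, (∀ i, r i ≤ 1) →
      L r = ((-1 : ℝ) ^ (∑ i, r i) / (2 + (-1 : ℝ) ^ (n + (∑ i, r i) - 1))) *
        L (fun _ => 0)) ∧
    (∀ L' : (Fin (n - 1) → ℕ) → ℝ,
      (∀ m r : Fin (n - 1) → ℕ, (∀ i, r i ≤ 1) →
        L' (fun i => 2 * m i + r i) =
          ((-1 : ℝ) ^ (∑ i, r i) / 2) *
            (L' m + (-1 : ℝ) ^ n * L' (fun i => m i + r i))) →
      L' (fun _ => 0) = L (fun _ => 0) → L' = L) := by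
  have corner : ∀ K : (Fin (n - 1) → ℕ) → ℝ,
      (∀ m r : Fin (n - 1) → ℕ, (∀ i, r i ≤ 1) →
        K (fun i => 2 * m i + r i) =
          ((-1 : ℝ) ^ (∑ i, r i) / 2) *
            (K m + (-1 : ℝ) ^ n * K (fun i => m i + r i))) →
      ∀ r : Fin (n - 1) → ℕ, (∀ i, r i ≤ 1) →
        K r = ((-1 : ℝ) ^ (∑ i, r i) / (2 + (-1 : ℝ) ^ (n + (∑ i, r i) - 1))) *
          K (fun _ => 0) := by
    intro K hK r hr
    have h := hK (fun _ => 0) r hr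
    simp only [mul_zero, zero_add] at h
    obtain ⟨k, rfl⟩ : ∃ k, n = k + 1 := ⟨n - 1, by omega⟩
    rw [show k + 1 + (∑ i, r i) - 1 = k + ∑ i, r i by omega, pow_add]
    rw [pow_succ] at h
    rcases neg_one_pow_eq_or ℝ k with hk | hk <;>
      rcases neg_one_pow_eq_or ℝ (∑ i, r i) with hs | hs <;>
      rw [hk, hs] at h ⊢ <;> linarith
  refine ⟨corner L hL, fun L' hL' h0 => ?_⟩
  suffices H : ∀ (N : ℕ) (m : Fin (n - 1) → ℕ), ∑ i, m i = N → L' m = L m from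
    funext fun m => H _ m rfl
  intro N
  induction N using Nat.strong_induction_on with
  | _ N ih =>
    intro m hm
    by_cases hc : ∀ i, m i ≤ 1
    · rw [corner L hL m hc, corner L' hL' m hc, h0]
    · push Not at hc
      obtain ⟨j, hj⟩ := hc
      have hr : ∀ i, m i % 2 ≤ 1 := fun i => by omega
      have hdiv : (fun i => 2 * (m i / 2) + m i % 2) = m := funext fun i => by omega
      have e := hL (fun i => m i / 2) (fun i => m i % 2) hr
      have e' := hL' (fun i => m i / 2) (fun i => m i % 2) hr
      simp only [hdiv] at e e'
      have h1 : ∑ i, m i / 2 < N := hm ▸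
        Finset.sum_lt_sum (fun i _ => by omega) ⟨j, Finset.mem_univ j, by omega⟩
      have h2 : ∑ i, (m i / 2 + m i % 2) < N := hm ▸
        Finset.sum_lt_sum (fun i _ => by omega) ⟨j, Finset.mem_univ j, by omega⟩
      rw [e, e', ih _ h1 _ rfl, ih _ h2 _ rfl]
end
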